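/- arXiv:2309.04299 — 3 statements merged into one kernel-verified Lean document; each statement's English description precedes it below -/
import Mathlib

section
/- Let Z be in the Siegel half-space H_n and set R = φ(Z) = (Z − iI)(Z + iI)^{-1}. Then: (i) R is symmetric (Rᵀ = R), so conj(R) = R† (the conjugate transpose); (ii) the cross-ratio matrix 𝔯(Z, iI) := (Z − iI)(Z + iI)^{-1}(conj(Z) + iI)(conj(Z) − iI)^{-1} equals R·conj(R); (iii) R·conj(R) is Hermitian and positive semidefinite. -/
noncomputable section
open Matrix Complex
open scoped ComplexOrder

/-- Entrywise complex conjugation of a matrix. -/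
def mconj {n : ℕ} (A : Matrix (Fin n) (Fin n) ℂ) : Matrix (Fin n) (Fin n) ℂ :=
  A.map (starRingEnd ℂ)

/-- The imaginary part `Im Z = (Z - conj Z)/(2i)` of a complex matrix. -/
def imPart {n : ℕ} (Z : Matrix (Fin n) (Fin n) ℂ) : Matrix (Fin n) (Fin n) ℂ :=
  (2 * Complex.I)⁻¹ • (Z - mconj Z)

/-- Membership in the Siegel half-space `H_n`. -/
def inSiegel {n : ℕ} (Z : Matrix (Fin n) (Fin n) ℂ) : Prop :=
  Z.IsSymm ∧ (imPart Z).PosDef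

/-- The Cayley transform `φ(Z) = (Z - iI)(Z + iI)⁻¹`. -/
def phi {n : ℕ} (Z : Matrix (Fin n) (Fin n) ℂ) : Matrix (Fin n) (Fin n) ℂ :=
  (Z - Complex.I • 1) * (Z + Complex.I • 1)⁻¹

/-- Siegel's matrix cross-ratio `𝔯(Z,Z₁)`. -/
def crossRatio {n : ℕ} (Z Z₁ : Matrix (Fin n) (Fin n) ℂ) : Matrix (Fin n) (Fin n) ℂ :=
  (Z - Z₁) * (Z - mconj Z₁)⁻¹ * (mconj Z - mconj Z₁) * (mconj Z - Z₁)⁻¹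

theorem Matrix.commute_nonsing_inv_right {m R : Type*} [Fintype m] [DecidableEq m] [CommRing R]
    {A B : Matrix m m R} (h : Commute A B) : Commute A B⁻¹ := by
  by_cases hB : IsUnit B
  · obtain ⟨u, rfl⟩ := hB
    rw [← coe_units_inv]
    exact h.units_inv_right
  · rw [nonsing_inv_eq_ringInverse, Ring.inverse_non_unit B hB]
    exact Commute.zero_right A

theorem mconj_eq_conjTranspose_transpose {n : ℕ} (A : Matrix (Fin n) (Fin n) ℂ) :
    mconj A = Aᴴᵀ := rfl

theorem Matrix.IsSymm.mconj_eq_conjTranspose {n : ℕ} {A : Matrix (Fin n) (Fin n) ℂ}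
    (hA : A.IsSymm) : mconj A = Aᴴ := by
  change Aᵀᴴ = Aᴴ
  rw [hA.eq]

theorem mconj_mul {n : ℕ} (A B : Matrix (Fin n) (Fin n) ℂ) :
    mconj (A * B) = mconj A * mconj B :=
  Matrix.map_mul

theorem mconj_inv {n : ℕ} (A : Matrix (Fin n) (Fin n) ℂ) : mconj A⁻¹ = (mconj A)⁻¹ := by
  simp only [mconj_eq_conjTranspose_transpose, conjTranspose_nonsing_inv, transpose_nonsing_inv]

theorem mconj_sub {n : ℕ} (A B : Matrix (Fin n) (Fin n) ℂ) :
    mconj (A - B) = mconj A - mconj B := by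
  simp [mconj_eq_conjTranspose_transpose]

theorem mconj_add {n : ℕ} (A B : Matrix (Fin n) (Fin n) ℂ) :
    mconj (A + B) = mconj A + mconj B := by
  simp [mconj_eq_conjTranspose_transpose]

theorem mconj_I_smul_one {n : ℕ} :
    mconj (Complex.I • (1 : Matrix (Fin n) (Fin n) ℂ)) = -(Complex.I • 1) := by
  simp [mconj_eq_conjTranspose_transpose]

theorem phi_isSymm {n : ℕ} {Z : Matrix (Fin n) (Fin n) ℂ} (hZ : Z.IsSymm) :
    (phi Z).IsSymm := by
  have hc : Commute (Z - Complex.I • 1) (Z + Complex.I • 1) := by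
    have h : Commute Z (Complex.I • 1) := (Commute.one_right Z).smul_right _
    exact ((Commute.refl Z).add_right h).sub_left (h.symm.add_right (Commute.refl _))
  simp only [IsSymm, phi, transpose_mul, transpose_nonsing_inv, transpose_add, transpose_sub,
    transpose_smul, transpose_one, hZ.eq]
  exact (commute_nonsing_inv_right hc).eq.symm

theorem crossRatio_I_smul_one {n : ℕ} (Z : Matrix (Fin n) (Fin n) ℂ) :
    crossRatio Z (Complex.I • 1) = phi Z * mconj (phi Z) := by
  simp only [crossRatio, phi, mconj_mul, mconj_inv, mconj_sub, mconj_add, mconj_I_smul_one,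
    sub_neg_eq_add, ← sub_eq_add_neg, Matrix.mul_assoc]

/-- For `Z` in the Siegel half-space with `R = φ(Z)`: `R` is symmetric (so its conjugate is
its conjugate transpose), the cross-ratio `𝔯(Z, iI)` equals `R ⬝ conj R`, and `R ⬝ conj R`
is Hermitian positive semidefinite. -/
theorem crossRatio_eq_R_mul_conj {n : ℕ} (Z : Matrix (Fin n) (Fin n) ℂ)
    (hZ : inSiegel Z) :
    (phi Z).IsSymm ∧
    mconj (phi Z) = (phi Z)ᴴ ∧
    crossRatio Z (Complex.I • 1) = phi Z * mconj (phi Z) ∧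
    (phi Z * mconj (phi Z)).IsHermitian ∧
    (phi Z * mconj (phi Z)).PosSemidef := by
  have hs := phi_isSymm hZ.1
  have hm := hs.mconj_eq_conjTranspose
  have hp : (phi Z * mconj (phi Z)).PosSemidef := by
    rw [hm]
    exact posSemidef_self_mul_conjTranspose _
  exact ⟨hs, hm, crossRatio_I_smul_one Z, hp.isHermitian, hp⟩
end
end

section
/- (Takagi factorization) Every n×n complex symmetric matrix A can be decomposed as A = Q M Qᵀ, where M = diag(μ₁, …, μₙ) is a real diagonal matrix with nonnegative entries and Q is an n×n unitary matrix. -/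
noncomputable section
open Matrix Complex

/-- A conjugate-linear symmetric operator on a nontrivial finite-dimensional complex inner product
space has a unit eigenvector with nonnegative real eigenvalue. -/
theorem exists_unit_coneigenvector {E : Type*} [NormedAddCommGroup E] [InnerProductSpace ℂ E]
    [FiniteDimensional ℂ E] [Nontrivial E] (T : E →ₗ⋆[ℂ] E)
    (hT : ∀ x y, inner ℂ (T x) y = inner ℂ (T y) x) :
    ∃ (v : E) (μ : ℝ), ‖v‖ = 1 ∧ 0 ≤ μ ∧ T v = (μ : ℂ) • v := by
  let : InnerProductSpace ℝ E := InnerProductSpace.rclikeToReal ℂ E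
  have : FiniteDimensional ℝ E := FiniteDimensional.complexToReal E
  let S : E →ₗ[ℝ] E :=
    { toFun := T
      map_add' := T.map_add
      map_smul' := fun r x => by
        change T ((r : ℂ) • x) = (r : ℂ) • T x
        rw [T.map_smulₛₗ, conj_ofReal] }
  have hS : S.IsSymmetric := fun x y => by
    change (inner ℂ (T x) y).re = (inner ℂ x (T y)).re
    rw [hT, ← inner_conj_symm, conj_re]
  obtain ⟨v, hv⟩ := hS.hasEigenvalue_iSup_of_finiteDimensional.exists_hasEigenvector
  generalize (⨆ x : { x : E // x ≠ 0 }, _ : ℝ) = c at hv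
  have hTv : T v = (c : ℂ) • v := hv.apply_eq_smul
  obtain ⟨w, μ, hw, hμ, hTw⟩ : ∃ (w : E) (μ : ℝ), w ≠ 0 ∧ 0 ≤ μ ∧ T w = (μ : ℂ) • w := by
    rcases le_total 0 c with hc | hc
    · exact ⟨v, c, hv.2, hc, hTv⟩
    · refine ⟨I • v, -c, smul_ne_zero I_ne_zero hv.2, neg_nonneg.2 hc, ?_⟩
      rw [T.map_smulₛₗ, hTv, smul_smul, smul_smul]
      congr 1
      simp [mul_comm]
  refine ⟨((‖w‖⁻¹ : ℝ) : ℂ) • w, μ, ?_, hμ, ?_⟩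
  · simp [norm_smul, hw]
  · rw [T.map_smulₛₗ, hTw, smul_comm, conj_ofReal]

/-- A conjugate-linear symmetric operator admits orthonormal families of eigenvectors, with
nonnegative real eigenvalues, of any size up to the dimension. -/
theorem exists_orthonormal_coneigenvectors {E : Type*} [NormedAddCommGroup E]
    [InnerProductSpace ℂ E] [FiniteDimensional ℂ E] (T : E →ₗ⋆[ℂ] E)
    (hT : ∀ x y, inner ℂ (T x) y = inner ℂ (T y) x) (k : ℕ) (hk : k ≤ Module.finrank ℂ E) :
    ∃ (v : Fin k → E) (μ : Fin k → ℝ),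
      Orthonormal ℂ v ∧ ∀ i, 0 ≤ μ i ∧ T (v i) = (μ i : ℂ) • v i := by
  induction k with
  | zero => exact ⟨Fin.elim0, Fin.elim0, ⟨fun i => i.elim0, fun i => i.elim0⟩, fun i => i.elim0⟩
  | succ k ih =>
    obtain ⟨v, μ, hv, hμ⟩ := ih (Nat.le_of_succ_le hk)
    let W : Submodule ℂ E := (Submodule.span ℂ (Set.range v))ᗮ
    have mem_W (x : E) : x ∈ W ↔ ∀ i, inner ℂ (v i) x = 0 := by
      refine ⟨fun hx i => hx _ (Submodule.subset_span ⟨i, rfl⟩), fun hx => ?_⟩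
      refine (Submodule.mem_orthogonal _ _).2 fun u hu => ?_
      induction hu using Submodule.span_induction with
      | mem u hu => obtain ⟨i, rfl⟩ := hu; exact hx i
      | zero => simp
      | add a b _ _ ha hb => simp [inner_add_left, ha, hb]
      | smul c a _ ha => simp [inner_smul_left, ha]
    have hTW (x : E) (hx : x ∈ W) : T x ∈ W := by
      refine (mem_W _).2 fun i => ?_
      rw [← inner_conj_symm, hT, (hμ i).2, inner_smul_left, (mem_W x).1 hx i]
      simp
    have : Nontrivial W := by
      apply Module.nontrivial_of_finrank_pos (R := ℂ)
      have h := Submodule.finrank_add_finrank_orthogonal (Submodule.span ℂ (Set.range v))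
      rw [finrank_span_eq_card hv.linearIndependent, Fintype.card_fin] at h
      change 0 < Module.finrank ℂ (Submodule.span ℂ (Set.range v))ᗮ
      omega
    let TW : W →ₗ⋆[ℂ] W := (T.domRestrict W).codRestrict W fun x => hTW x x.2
    obtain ⟨w, c, hw, hc, hTw⟩ := exists_unit_coneigenvector TW fun x y => hT x y
    have hvw (i : Fin k) : inner ℂ (v i) (w : E) = 0 := (mem_W w).1 w.2 i
    refine ⟨Fin.cons (w : E) v, Fin.cons c μ, ⟨?_, ?_⟩, ?_⟩
    · exact Fin.cases hw hv.1
    · intro i j hij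
      induction i using Fin.cases with
      | zero =>
        induction j using Fin.cases with
        | zero => exact absurd rfl hij
        | succ j => simpa using inner_eq_zero_symm.1 (hvw j)
      | succ i =>
        induction j using Fin.cases with
        | zero => simpa using hvw i
        | succ j => simpa using hv.2 fun h => hij (congrArg Fin.succ h)
    · exact Fin.cases ⟨hc, congrArg Subtype.val hTw⟩ hμ

/-- **Takagi factorization.** Every complex symmetric matrix `A` can be written as
`A = Q M Qᵀ` with `Q` unitary and `M` a real nonnegative diagonal matrix. -/
theorem takagi_factorization {n : ℕ} (A : Matrix (Fin n) (Fin n) ℂ)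
    (hA : A.IsSymm) :
    ∃ (Q : Matrix (Fin n) (Fin n) ℂ) (μ : Fin n → ℝ),
      Q * Qᴴ = 1 ∧ (∀ i, 0 ≤ μ i) ∧
      A = Q * Matrix.diagonal (fun i => (μ i : ℂ)) * Qᵀ := by
  let T : EuclideanSpace ℂ (Fin n) →ₗ⋆[ℂ] EuclideanSpace ℂ (Fin n) :=
    { toFun := fun x => WithLp.toLp 2 (A *ᵥ star x.ofLp)
      map_add' := fun x y => by simp [mulVec_add]
      map_smul' := fun c x => by simp [mulVec_smul] }
  have hT (x y : EuclideanSpace ℂ (Fin n)) : inner ℂ (T x) y = inner ℂ (T y) x := by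
    change y.ofLp ⬝ᵥ star (A *ᵥ star x.ofLp) = x.ofLp ⬝ᵥ star (A *ᵥ star y.ofLp)
    have hAH : (Aᴴ)ᵀ = Aᴴ := by
      rw [conjTranspose, hA.eq, ← transpose_map, hA.eq]
    rw [star_mulVec, star_mulVec, star_star, star_star, dotProduct_comm, ← dotProduct_mulVec,
      ← vecMul_transpose, hAH]
  obtain ⟨v, μ, hv, hμ⟩ := exists_orthonormal_coneigenvectors T hT n (by simp)
  let Q : Matrix (Fin n) (Fin n) ℂ := of fun i j => v j i
  have hQ' : Qᴴ * Q = 1 := by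
    ext i j
    have h := orthonormal_iff_ite.1 hv i j
    rw [PiLp.inner_apply] at h
    simpa [Q, mul_apply, one_apply, mul_comm] using h
  have hQ : Q * Qᴴ = 1 := mul_eq_one_comm.1 hQ'
  refine ⟨Q, μ, hQ, fun i => (hμ i).1, ?_⟩
  have hAQ : A * Qᴴᵀ = Q * diagonal (fun i => (μ i : ℂ)) := by
    ext i j
    have h := congrArg (fun x : EuclideanSpace ℂ (Fin n) => x i) (hμ j).2
    rw [mul_diagonal, mul_comm]
    exact h
  rw [← hAQ, Matrix.mul_assoc, ← transpose_mul, hQ, transpose_one, Matrix.mul_one]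
end
end

section
/- Let n ≥ 1, Ω_n = {σ ∈ ℝⁿ : 0 < σ¹ < σ² < … < σⁿ}, and S(σ) = Σ_{k=1}^n log sinh σ^k + Σ_{1≤k<l≤n} log|cosh σ^k − cosh σ^l| on Ω_n. Then S satisfies the identity ΔS(σ) + |∇S(σ)|² = n(n+1)(2n+1)/6 for all σ ∈ Ω_n, where Δ = Σ_k ∂²/∂(σ^k)² is the Euclidean Laplacian and |∇S|² = Σ_k (∂S/∂σ^k)². -/
noncomputable section
open Real

/-- The open chamber `Ω_n = {σ ∈ ℝⁿ : 0 < σ¹ < σ² < … < σⁿ}`. -/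
def chamber (n : ℕ) : Set (Fin n → ℝ) :=
  {σ | (∀ k, 0 < σ k) ∧ StrictMono σ}

/-- The Boltzmann entropy
`S(σ) = Σ_k log sinh σ^k + Σ_{k<l} log|cosh σ^k − cosh σ^l|`. -/
def entropy {n : ℕ} (σ : Fin n → ℝ) : ℝ :=
  (∑ k, Real.log (Real.sinh (σ k)))
  + ∑ k, ∑ l ∈ Finset.univ.filter (fun l => k < l),
      Real.log |Real.cosh (σ k) - Real.cosh (σ l)|

theorem sum_sum_filter_lt_of_symm {n : ℕ} (f : Fin n → Fin n → ℝ)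
    (hsymm : ∀ i j, f i j = f j i) (hdiag : ∀ i, f i i = 0) :
    ∑ i, ∑ j ∈ Finset.univ.filter (fun j => i < j), f i j = (∑ i, ∑ j, f i j) / 2 := by
  have hsplit : ∑ i, ∑ j, f i j = ∑ i, ∑ j, (if i < j then f i j else 0)
      + ∑ i, ∑ j, (if j < i then f i j else 0) := by
    simp only [← Finset.sum_add_distrib]
    refine Finset.sum_congr rfl fun i _ => Finset.sum_congr rfl fun j _ => ?_
    rcases lt_trichotomy i j with h | rfl | h
    · simp [h, h.not_gt]
    · simp [hdiag]
    · simp [h, h.not_gt]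
  have hswap : ∑ i, ∑ j, (if j < i then f i j else 0)
      = ∑ i, ∑ j, (if i < j then f i j else 0) := by
    rw [Finset.sum_comm]
    refine Finset.sum_congr rfl fun i _ => Finset.sum_congr rfl fun j _ => ?_
    rw [hsymm]
  simp only [Finset.sum_filter]
  linarith

theorem entropy_eq_half_sum {n : ℕ} (σ : Fin n → ℝ) :
    entropy σ = ∑ i, log (sinh (σ i)) + (∑ i, ∑ j, log (cosh (σ i) - cosh (σ j))) / 2 := by
  rw [entropy, sum_sum_filter_lt_of_symm (fun i j => log |cosh (σ i) - cosh (σ j)|)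
    (fun i j => by rw [abs_sub_comm]) (fun i => by simp)]
  simp only [log_abs]

/-- The entropy along a coordinate slice, up to a constant. -/
theorem exists_entropy_update_eq {n : ℕ} (σ : Fin n → ℝ) (k : Fin n) :
    ∃ C : ℝ, ∀ t, entropy (Function.update σ k t)
      = C + (log (sinh t) + ∑ l ∈ Finset.univ.erase k, log (cosh t - cosh (σ l))) := by
  refine ⟨∑ i ∈ Finset.univ.erase k, log (sinh (σ i)) + (∑ i ∈ Finset.univ.erase k,
    ∑ j ∈ Finset.univ.erase k, log (cosh (σ i) - cosh (σ j))) / 2, fun t => ?_⟩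
  have hsum (f : Fin n → ℝ → ℝ) : ∑ i, f i (Function.update σ k t i)
      = f k t + ∑ i ∈ Finset.univ.erase k, f i (σ i) := by
    rw [← Finset.add_sum_erase _ _ (Finset.mem_univ k), Function.update_self]
    congr 1
    refine Finset.sum_congr rfl fun i hi => ?_
    rw [Function.update_of_ne (Finset.ne_of_mem_erase hi)]
  have hcomm : ∑ i ∈ Finset.univ.erase k, log (cosh (σ i) - cosh t)
      = ∑ i ∈ Finset.univ.erase k, log (cosh t - cosh (σ i)) :=
    Finset.sum_congr rfl fun i _ => by rw [← log_abs, abs_sub_comm, log_abs]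
  rw [entropy_eq_half_sum, hsum (fun _ x => log (sinh x)),
    hsum (fun _ x => ∑ j, log (cosh x - cosh (Function.update σ k t j))),
    hsum (fun _ y => log (cosh t - cosh y))]
  simp only [fun x => hsum (fun _ y => log (cosh x - cosh y)), Finset.sum_add_distrib]
  rw [hcomm, sub_self, log_zero]
  ring

theorem hasDerivAt_entropy_update {n : ℕ} (σ : Fin n → ℝ) (k : Fin n) {t : ℝ}
    (ht : sinh t ≠ 0) (htl : ∀ l ≠ k, cosh t - cosh (σ l) ≠ 0) :
    HasDerivAt (fun t => entropy (Function.update σ k t))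
      (cosh t / sinh t + ∑ l ∈ Finset.univ.erase k, sinh t / (cosh t - cosh (σ l))) t := by
  obtain ⟨C, hC⟩ := exists_entropy_update_eq σ k
  simp only [hC]
  refine HasDerivAt.const_add C (((hasDerivAt_sinh t).log ht).add ?_)
  refine HasDerivAt.fun_sum fun l hl => ?_
  exact ((hasDerivAt_cosh t).sub_const _).log (htl l (Finset.ne_of_mem_erase hl))

theorem iteratedDeriv_two_entropy_update {n : ℕ} (σ : Fin n → ℝ) (k : Fin n) {t : ℝ}
    (ht : sinh t ≠ 0) (htl : ∀ l ≠ k, cosh t - cosh (σ l) ≠ 0) :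
    iteratedDeriv 2 (fun t => entropy (Function.update σ k t)) t
      = (sinh t * sinh t - cosh t * cosh t) / sinh t ^ 2
        + ∑ l ∈ Finset.univ.erase k,
          (cosh t * (cosh t - cosh (σ l)) - sinh t * sinh t) / (cosh t - cosh (σ l)) ^ 2 := by
  have hderiv : deriv (fun t => entropy (Function.update σ k t)) =ᶠ[nhds t]
      fun t => cosh t / sinh t + ∑ l ∈ Finset.univ.erase k, sinh t / (cosh t - cosh (σ l)) := by
    have hs : ∀ᶠ x in nhds t, sinh x ≠ 0 := continuous_sinh.continuousAt.eventually_ne ht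
    have hl : ∀ᶠ x in nhds t, ∀ l ≠ k, cosh x - cosh (σ l) ≠ 0 := by
      simp only [Filter.eventually_all]
      exact fun l h => (continuous_cosh.sub continuous_const).continuousAt.eventually_ne (htl l h)
    filter_upwards [hs, hl] with x hx hxl
    exact (hasDerivAt_entropy_update σ k hx hxl).deriv
  rw [iteratedDeriv_succ, iteratedDeriv_one, hderiv.deriv_eq]
  refine HasDerivAt.deriv (((hasDerivAt_cosh t).div (hasDerivAt_sinh t) ht).add ?_)
  refine HasDerivAt.fun_sum fun l hl => ?_
  exact (hasDerivAt_sinh t).div ((hasDerivAt_cosh t).sub_const _)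
    (htl l (Finset.ne_of_mem_erase hl))

section Identities

variable {n : ℕ} {c : Fin n → ℝ}

theorem sum_sum_div_sub (hc : Function.Injective c) :
    ∑ k, ∑ l, c k / (c k - c l) = (n : ℝ) * (n - 1) / 2 := by
  have hpair : ∑ k, ∑ l, (c k / (c k - c l) + c l / (c l - c k)) = (n : ℝ) * (n - 1) := by
    have hterm (k l : Fin n) :
        c k / (c k - c l) + c l / (c l - c k) = 1 - if k = l then 1 else 0 := by
      by_cases h : k = l
      · simp [h]
      · have h₁ : c k - c l ≠ 0 := sub_ne_zero.2 (hc.ne h)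
        have h₂ : c l - c k ≠ 0 := sub_ne_zero.2 (hc.ne (Ne.symm h))
        rw [if_neg h]
        field_simp
        ring
    simp [hterm, Finset.sum_sub_distrib]
    ring
  simp only [Finset.sum_add_distrib] at hpair
  rw [Finset.sum_comm (f := fun k l => c l / (c l - c k))] at hpair
  linarith

theorem sum_mul_sq_sum_sub_sum_sq (hc : Function.Injective c) :
    ∑ k, (c k ^ 2 - 1) * ((∑ l, 1 / (c k - c l)) ^ 2 - ∑ l, (1 / (c k - c l)) ^ 2)
      = (n : ℝ) * (n - 1) * (n - 2) / 3 := by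
  set F : Fin n → Fin n → Fin n → ℝ := fun k l m =>
    (c k ^ 2 - 1) * (1 / (c k - c l) * (1 / (c k - c m))
      - if l = m then (1 / (c k - c l)) ^ 2 else 0) with hF
  have hsum : ∑ k, (c k ^ 2 - 1) * ((∑ l, 1 / (c k - c l)) ^ 2 - ∑ l, (1 / (c k - c l)) ^ 2)
      = ∑ k, ∑ l, ∑ m, F k l m := by
    refine Finset.sum_congr rfl fun k _ => ?_
    simp only [hF, ← Finset.mul_sum, Finset.sum_sub_distrib, Finset.sum_ite_eq, Finset.mem_univ,
      if_true, ← Finset.sum_mul, sq (∑ l, _)]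
  have hterm (k l m : Fin n) : F k l m + F l m k + F m k l
      = 1 - (if k = l then 1 else 0) - (if l = m then 1 else 0) - (if k = m then 1 else 0)
        + 2 * (if k = l then if l = m then 1 else 0 else 0) := by
    by_cases hkl : k = l
    · subst hkl
      by_cases hkm : k = m
      · subst hkm
        simp [hF]
        norm_num
      · simp [hF, hkm, Ne.symm hkm, sq]
    · by_cases hlm : l = m
      · subst hlm
        simp [hF, hkl, Ne.symm hkl, sq]
      · by_cases hkm : k = m
        · subst hkm
          simp [hF, hkl, Ne.symm hkl, sq]
        · have h₁ : c k - c l ≠ 0 := sub_ne_zero.2 (hc.ne hkl)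
          have h₂ : c l - c m ≠ 0 := sub_ne_zero.2 (hc.ne hlm)
          have h₃ : c k - c m ≠ 0 := sub_ne_zero.2 (hc.ne hkm)
          simp only [hF, if_neg hkl, if_neg hlm, if_neg hkm, if_neg (Ne.symm hkm)]
          rw [← neg_sub (c k) (c l), ← neg_sub (c l) (c m), ← neg_sub (c k) (c m)]
          field_simp
          ring
  have hcyc₁ : ∑ k, ∑ l, ∑ m, F l m k = ∑ k, ∑ l, ∑ m, F k l m := by
    rw [Finset.sum_comm]
    exact Finset.sum_congr rfl fun l _ => Finset.sum_comm
  have hcyc₂ : ∑ k, ∑ l, ∑ m, F m k l = ∑ k, ∑ l, ∑ m, F k l m := by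
    rw [Finset.sum_comm (f := fun m k => ∑ l, F m k l)]
    exact Finset.sum_congr rfl fun k _ => Finset.sum_comm
  have htotal : ∑ k, ∑ l, ∑ m, (F k l m + F l m k + F m k l)
      = (n : ℝ) * (n - 1) * (n - 2) := by
    simp [hterm, Finset.sum_add_distrib, Finset.sum_sub_distrib]
    ring
  simp only [Finset.sum_add_distrib, hcyc₁, hcyc₂] at htotal
  rw [hsum]
  linarith

end Identities

/-- On the open chamber, the entropy satisfies the identity
`ΔS + |∇S|² = n(n+1)(2n+1)/6`, with `Δ` the Euclidean Laplacian (computed as the sum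
of second derivatives of the one-variable coordinate slices) and `∇` the Euclidean
gradient. -/
theorem entropy_laplacian_identity {n : ℕ} (hn : 1 ≤ n) (σ : Fin n → ℝ)
    (hσ : σ ∈ chamber n) :
    (∑ k, iteratedDeriv 2 (fun t => entropy (Function.update σ k t)) (σ k))
    + ∑ k, (deriv (fun t => entropy (Function.update σ k t)) (σ k)) ^ 2
      = (n : ℝ) * (n + 1) * (2 * n + 1) / 6 := by

  obtain ⟨hpos, hmono⟩ := hσ
  have hc : Function.Injective fun k => cosh (σ k) := fun k l h =>
    hmono.injective (cosh_strictMonoOn.injOn (hpos k).le (hpos l).le h)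
  have hs (k : Fin n) : sinh (σ k) ≠ 0 := (sinh_pos_iff.2 (hpos k)).ne'
  have hne (k l : Fin n) (h : l ≠ k) : cosh (σ k) - cosh (σ l) ≠ 0 :=
    sub_ne_zero.2 (hc.ne h.symm)
  have hterm (k : Fin n) :
      iteratedDeriv 2 (fun t => entropy (Function.update σ k t)) (σ k)
        + (deriv (fun t => entropy (Function.update σ k t)) (σ k)) ^ 2
      = 1 + 3 * ∑ l, cosh (σ k) / (cosh (σ k) - cosh (σ l))
        + (cosh (σ k) ^ 2 - 1) * ((∑ l, 1 / (cosh (σ k) - cosh (σ l))) ^ 2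
          - ∑ l, (1 / (cosh (σ k) - cosh (σ l))) ^ 2) := by
    have hfirst : ∑ l ∈ Finset.univ.erase k, sinh (σ k) / (cosh (σ k) - cosh (σ l))
        = sinh (σ k) * ∑ l, 1 / (cosh (σ k) - cosh (σ l)) := by
      rw [Finset.sum_erase _ (by simp), Finset.mul_sum]
      exact Finset.sum_congr rfl fun l _ => by ring
    have hsecond : ∑ l ∈ Finset.univ.erase k,
          (cosh (σ k) * (cosh (σ k) - cosh (σ l)) - sinh (σ k) * sinh (σ k))
            / (cosh (σ k) - cosh (σ l)) ^ 2
        = cosh (σ k) * ∑ l, 1 / (cosh (σ k) - cosh (σ l))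
          - sinh (σ k) ^ 2 * ∑ l, (1 / (cosh (σ k) - cosh (σ l))) ^ 2 := by
      rw [Finset.sum_erase _ (by simp), Finset.mul_sum, Finset.mul_sum,
        ← Finset.sum_sub_distrib]
      refine Finset.sum_congr rfl fun l _ => ?_
      by_cases h : l = k
      · simp [h]
      · have := hne k l h
        field_simp
    have hthird : ∑ l, cosh (σ k) / (cosh (σ k) - cosh (σ l))
        = cosh (σ k) * ∑ l, 1 / (cosh (σ k) - cosh (σ l)) := by
      rw [Finset.mul_sum]
      exact Finset.sum_congr rfl fun l _ => by ring
    rw [iteratedDeriv_two_entropy_update σ k (hs k) (hne k),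
      (hasDerivAt_entropy_update σ k (hs k) (hne k)).deriv, hfirst, hsecond, hthird,
      ← sinh_sq]
    have := hs k
    field_simp
    ring
  rw [← Finset.sum_add_distrib, Finset.sum_congr rfl fun k _ => hterm k,
    Finset.sum_add_distrib, Finset.sum_add_distrib, ← Finset.mul_sum, sum_sum_div_sub hc,
    sum_mul_sq_sum_sub_sum_sq hc]
  simp only [Finset.sum_const, Finset.card_univ, Fintype.card_fin, nsmul_eq_mul, mul_one]
  ring
end
end
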